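/- (Another expression of the second-order general formula.) For any general source X, any R ≥ 0, and any ε, δ ∈ [0,1) satisfying ε + δ < 1, it holds that G_{ε,δ}(R|X) = H̄_{ε+δ}(R|X). -/

import Mathlib

open Filter MeasureTheory

namespace NY

/-- A probability distribution on a set, given by its point mass function. -/
structure Dist (α : Type*) where
  p : α → ℝ
  nonneg : ∀ x, 0 ≤ p x
  hasSum : HasSum p 1

/-- The probability of a set under a distribution. -/
noncomputable def Dist.pr {α : Type*} (P : Dist α) (A : Set α) : ℝ := ∑' x : A, P.p x.1

/-- 𝒰* : nonempty finite strings over the code alphabet 𝒰 = {1,…,K}. -/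
abbrev Word (K : ℕ) := {u : List (Fin K) // u ≠ []}

/-- Length of a string, as a real number. -/
noncomputable def wlen {K : ℕ} (u : Word K) : ℝ := u.1.length

/-- Error probability of a variable-length code (φ, ψ). -/
noncomputable def errP {α : Type*} {K : ℕ} (P : Dist α) (φ : α → Word K) (ψ : Word K → α) : ℝ :=
  P.pr {x | ψ (φ x) ≠ x}

/-- Overflow probability of an encoder φ with threshold η. -/
noncomputable def ovP {α : Type*} {K : ℕ} (P : Dist α) (φ : α → Word K) (η : ℝ) : ℝ :=
  P.pr {x | wlen (φ x) > η}

/-- A general source: for each blocklength n, a distribution on 𝒳^n. -/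
abbrev Source (𝒳 : Type*) := (n : ℕ) → Dist (Fin n → 𝒳)

/-- The limit as ν ↓ 0 of a function g which is nonincreasing in ν
(the limit exists by monotonicity and equals the supremum over ν > 0). -/
noncomputable def limNu (g : ℝ → ℝ) : ℝ := sSup (g '' Set.Ioi (0 : ℝ))

variable {𝒳 : Type*}

/-- A rate R ≥ 0 is (ε,δ)-achievable. -/
def FirstAch (K : ℕ) (X : Source 𝒳) (ε δ R : ℝ) : Prop :=
  0 ≤ R ∧ ∃ (φ : ∀ n, (Fin n → 𝒳) → Word K) (ψ : ∀ n, Word K → (Fin n → 𝒳)),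
    limsup (fun n => errP (X n) (φ n) (ψ n)) atTop ≤ ε ∧
    limsup (fun n => ovP (X n) (φ n) ((n : ℝ) * R)) atTop ≤ δ

/-- The first-order (ε,δ)-optimum threshold R(ε,δ|X). -/
noncomputable def Ropt (K : ℕ) (X : Source 𝒳) (ε δ : ℝ) : ℝ :=
  sInf {R | FirstAch K X ε δ R}

/-- L is (ε,δ,R)-achievable (second order). -/
def SecondAch (K : ℕ) (X : Source 𝒳) (ε δ R L : ℝ) : Prop :=
  ∃ (φ : ∀ n, (Fin n → 𝒳) → Word K) (ψ : ∀ n, Word K → (Fin n → 𝒳)),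
    limsup (fun n => errP (X n) (φ n) (ψ n)) atTop ≤ ε ∧
    limsup (fun n => ovP (X n) (φ n) ((n : ℝ) * R + Real.sqrt (n : ℝ) * L)) atTop ≤ δ

/-- The second-order (ε,δ,R)-optimum threshold L(ε,δ,R|X). -/
noncomputable def Lopt (K : ℕ) (X : Source 𝒳) (ε δ R : ℝ) : ℝ :=
  sInf {L | SecondAch K X ε δ R L}

/-- A rate R ≥ 0 is optimistically (ε,δ)-achievable. -/
def OptFirstAch (K : ℕ) (X : Source 𝒳) (ε δ R : ℝ) : Prop :=
  0 ≤ R ∧ ∃ (φ : ∀ n, (Fin n → 𝒳) → Word K) (ψ : ∀ n, Word K → (Fin n → 𝒳)),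
    ∀ γ > (0 : ℝ), ∃ ns : ℕ → ℕ, StrictMono ns ∧ ∀ i,
      errP (X (ns i)) (φ (ns i)) (ψ (ns i)) ≤ ε + γ ∧
      ovP (X (ns i)) (φ (ns i)) ((ns i : ℝ) * R) ≤ δ + γ

/-- The optimistic first-order (ε,δ)-optimum threshold R*(ε,δ|X). -/
noncomputable def RoptStar (K : ℕ) (X : Source 𝒳) (ε δ : ℝ) : ℝ :=
  sInf {R | OptFirstAch K X ε δ R}

/-- L is optimistically (ε,δ,R)-achievable. -/
def OptSecondAch (K : ℕ) (X : Source 𝒳) (ε δ R L : ℝ) : Prop :=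
  ∃ (φ : ∀ n, (Fin n → 𝒳) → Word K) (ψ : ∀ n, Word K → (Fin n → 𝒳)),
    ∀ γ > (0 : ℝ), ∃ ns : ℕ → ℕ, StrictMono ns ∧ ∀ i,
      errP (X (ns i)) (φ (ns i)) (ψ (ns i)) ≤ ε + γ ∧
      ovP (X (ns i)) (φ (ns i)) ((ns i : ℝ) * R + Real.sqrt (ns i : ℝ) * L) ≤ δ + γ

/-- The optimistic second-order (ε,δ,R)-optimum threshold L*(ε,δ,R|X). -/
noncomputable def LoptStar (K : ℕ) (X : Source 𝒳) (ε δ R : ℝ) : ℝ :=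
  sInf {L | OptSecondAch K X ε δ R L}

/-- A rate R ≥ 0 is type I (ε,δ)-achievable. -/
def TypeIAch (K : ℕ) (X : Source 𝒳) (ε δ R : ℝ) : Prop :=
  0 ≤ R ∧ ∃ (φ : ∀ n, (Fin n → 𝒳) → Word K) (ψ : ∀ n, Word K → (Fin n → 𝒳)),
    limsup (fun n => errP (X n) (φ n) (ψ n)) atTop ≤ ε ∧
    liminf (fun n => ovP (X n) (φ n) ((n : ℝ) * R)) atTop ≤ δ

/-- R†(ε,δ|X). -/
noncomputable def Rdagger (K : ℕ) (X : Source 𝒳) (ε δ : ℝ) : ℝ :=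
  sInf {R | TypeIAch K X ε δ R}

/-- A rate R ≥ 0 is type II (ε,δ)-achievable. -/
def TypeIIAch (K : ℕ) (X : Source 𝒳) (ε δ R : ℝ) : Prop :=
  0 ≤ R ∧ ∃ (φ : ∀ n, (Fin n → 𝒳) → Word K) (ψ : ∀ n, Word K → (Fin n → 𝒳)),
    liminf (fun n => errP (X n) (φ n) (ψ n)) atTop ≤ ε ∧
    limsup (fun n => ovP (X n) (φ n) ((n : ℝ) * R)) atTop ≤ δ

/-- R‡(ε,δ|X). -/
noncomputable def Rddagger (K : ℕ) (X : Source 𝒳) (ε δ : ℝ) : ℝ :=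
  sInf {R | TypeIIAch K X ε δ R}

/-- H̄_γ(X) := inf{ R : limsup_n Pr{ (1/n) log(1/P_{X^n}(X^n)) > R } ≤ γ }. -/
noncomputable def Hbar (K : ℕ) (X : Source 𝒳) (γ : ℝ) : ℝ :=
  sInf {R | limsup (fun n =>
    (X n).pr {x | Real.logb (K : ℝ) (1 / (X n).p x) / (n : ℝ) > R}) atTop ≤ γ}

/-- H̄*_γ(X) (optimistic version, with liminf). -/
noncomputable def HbarStar (K : ℕ) (X : Source 𝒳) (γ : ℝ) : ℝ :=
  sInf {R | liminf (fun n =>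
    (X n).pr {x | Real.logb (K : ℝ) (1 / (X n).p x) / (n : ℝ) > R}) atTop ≤ γ}

/-- H̄_γ(R|X) := inf{ L : limsup_n Pr{ (1/n) log(1/P_{X^n}(X^n)) > R + L/√n } ≤ γ }. -/
noncomputable def Hbar2 (K : ℕ) (X : Source 𝒳) (γ R : ℝ) : ℝ :=
  sInf {L | limsup (fun n =>
    (X n).pr {x | Real.logb (K : ℝ) (1 / (X n).p x) / (n : ℝ)
      > R + L / Real.sqrt (n : ℝ)}) atTop ≤ γ}

/-- H̄*_γ(R|X) (optimistic version, with liminf). -/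
noncomputable def Hbar2Star (K : ℕ) (X : Source 𝒳) (γ R : ℝ) : ℝ :=
  sInf {L | liminf (fun n =>
    (X n).pr {x | Real.logb (K : ℝ) (1 / (X n).p x) / (n : ℝ)
      > R + L / Real.sqrt (n : ℝ)}) atTop ≤ γ}

/-- F(ε,R) := limsup_n inf_{A : Pr(A) ≥ 1−ε} Pr{ −(1/n) log P_{X^n}(X^n) ≥ R, X^n ∈ A }. -/
noncomputable def Fspec (K : ℕ) (X : Source 𝒳) (ε R : ℝ) : ℝ :=
  limsup (fun n =>
    sInf ((fun A : Set (Fin n → 𝒳) =>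
        (X n).pr (A ∩ {x | -Real.logb (K : ℝ) ((X n).p x) / (n : ℝ) ≥ R})) ''
      {A | (X n).pr A ≥ 1 - ε})) atTop

/-- H̃_{ε,δ}(X) := inf{ R : F(ε,R) ≤ δ }. -/
noncomputable def Htilde (K : ℕ) (X : Source 𝒳) (ε δ : ℝ) : ℝ :=
  sInf {R | Fspec K X ε R ≤ δ}

/-- G_{ε,δ}(X). -/
noncomputable def Gfirst (K : ℕ) (X : Source 𝒳) (ε δ : ℝ) : ℝ :=
  sInf {R | limNu (fun ν => limsup (fun n =>
    sInf ((fun A : Set (Fin n → 𝒳) =>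
        (X n).pr (A ∩ {x | -Real.logb (K : ℝ) ((X n).p x / (X n).pr A) / (n : ℝ) ≥ R})) ''
      {A | (X n).pr A ≥ 1 - ε - ν})) atTop) ≤ δ}

/-- G*_{ε,δ}(X) (optimistic version, with liminf). -/
noncomputable def GfirstStar (K : ℕ) (X : Source 𝒳) (ε δ : ℝ) : ℝ :=
  sInf {R | limNu (fun ν => liminf (fun n =>
    sInf ((fun A : Set (Fin n → 𝒳) =>
        (X n).pr (A ∩ {x | -Real.logb (K : ℝ) ((X n).p x / (X n).pr A) / (n : ℝ) ≥ R})) ''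
      {A | (X n).pr A ≥ 1 - ε - ν})) atTop) ≤ δ}

/-- G_{ε,δ}(R|X). -/
noncomputable def Gsecond (K : ℕ) (X : Source 𝒳) (ε δ R : ℝ) : ℝ :=
  sInf {L | limNu (fun ν => limsup (fun n =>
    sInf ((fun A : Set (Fin n → 𝒳) =>
        (X n).pr (A ∩ {x | -Real.logb (K : ℝ) ((X n).p x / (X n).pr A) / (n : ℝ)
          ≥ R + L / Real.sqrt (n : ℝ)})) ''
      {A | (X n).pr A ≥ 1 - ε - ν})) atTop) ≤ δ}

/-- G*_{ε,δ}(R|X) (optimistic version, with liminf). -/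
noncomputable def GsecondStar (K : ℕ) (X : Source 𝒳) (ε δ R : ℝ) : ℝ :=
  sInf {L | limNu (fun ν => liminf (fun n =>
    sInf ((fun A : Set (Fin n → 𝒳) =>
        (X n).pr (A ∩ {x | -Real.logb (K : ℝ) ((X n).p x / (X n).pr A) / (n : ℝ)
          ≥ R + L / Real.sqrt (n : ℝ)})) ''
      {A | (X n).pr A ≥ 1 - ε - ν})) atTop) ≤ δ}

/-- A rate R is optimistically ε-achievable by fixed-length codes. -/
def FixAchR (K : ℕ) (X : Source 𝒳) (ε R : ℝ) : Prop :=
  ∃ (M : ℕ → ℕ) (φ : ∀ n, (Fin n → 𝒳) → Fin (M n)) (ψ : ∀ n, Fin (M n) → (Fin n → 𝒳)),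
    ∀ γ > (0 : ℝ), ∃ ns : ℕ → ℕ, StrictMono ns ∧ ∀ i,
      (X (ns i)).pr {x | ψ (ns i) (φ (ns i) x) ≠ x} ≤ ε + γ ∧
      Real.logb (K : ℝ) (M (ns i) : ℝ) / (ns i : ℝ) ≤ R + γ

/-- R^f(ε|X). -/
noncomputable def Rfix (K : ℕ) (X : Source 𝒳) (ε : ℝ) : ℝ :=
  sInf {R | FixAchR K X ε R}

/-- A real L is optimistically (ε,R)-achievable by fixed-length codes. -/
def FixAchL (K : ℕ) (X : Source 𝒳) (ε R L : ℝ) : Prop :=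
  ∃ (M : ℕ → ℕ) (φ : ∀ n, (Fin n → 𝒳) → Fin (M n)) (ψ : ∀ n, Fin (M n) → (Fin n → 𝒳)),
    ∀ γ > (0 : ℝ), ∃ ns : ℕ → ℕ, StrictMono ns ∧ ∀ i,
      (X (ns i)).pr {x | ψ (ns i) (φ (ns i) x) ≠ x} ≤ ε + γ ∧
      Real.logb (K : ℝ) ((M (ns i) : ℝ) / (K : ℝ) ^ ((ns i : ℝ) * R)) / Real.sqrt (ns i : ℝ)
        ≤ L + γ

/-- L^f(ε,R|X). -/
noncomputable def Lfix (K : ℕ) (X : Source 𝒳) (ε R : ℝ) : ℝ :=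
  sInf {L | FixAchL K X ε R L}

theorem sInf_eq_aux (S T : Set ℝ) (h1 : ∀ L ∈ S, ∀ L' > L, L' ∈ T)
    (h2 : ∀ L ∈ T, ∀ L' > L, L' ∈ S) : sInf S = sInf T := by
  have lb : ∀ S T : Set ℝ, (∀ L ∈ S, ∀ L' > L, L' ∈ T) → ∀ b, b ∈ lowerBounds T →
      b ∈ lowerBounds S := by
    intro S T h b hb L hL
    exact le_of_forall_gt_imp_ge_of_dense fun a ha => hb (h L hL a ha)
  by_cases hS : S.Nonempty
  · have hT : T.Nonempty := by
      obtain ⟨L, hL⟩ := hS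
      exact ⟨L + 1, h1 L hL _ (by linarith)⟩
    by_cases hb : BddBelow S
    · have hbT : BddBelow T := by
        obtain ⟨b, hb⟩ := hb
        exact ⟨b, lb T S h2 b hb⟩
      apply le_antisymm
      · exact le_csInf hT (lb T S h2 _ fun x hx => csInf_le hb hx)
      · exact le_csInf hS (lb S T h1 _ fun x hx => csInf_le hbT hx)
    · have hbT : ¬ BddBelow T := by
        rintro ⟨b, hb'⟩
        exact hb ⟨b, lb S T h1 b hb'⟩
      rw [Real.sInf_of_not_bddBelow hb, Real.sInf_of_not_bddBelow hbT]
  · have hT : ¬ T.Nonempty := by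
      rintro ⟨L, hL⟩
      exact hS ⟨L + 1, h2 L hL _ (by linarith)⟩
    rw [Set.not_nonempty_iff_eq_empty.1 hS, Set.not_nonempty_iff_eq_empty.1 hT]

theorem ls_le {u : ℕ → ℝ} (h0 : ∀ n, 0 ≤ u n) {a : ℝ} (h : ∀ᶠ n in atTop, u n ≤ a) :
    limsup u atTop ≤ a :=
  limsup_le_of_le (isBoundedUnder_of ⟨0, h0⟩ : IsBoundedUnder (· ≥ ·) atTop u).isCoboundedUnder_le h

theorem ls_lt {u : ℕ → ℝ} (h1 : ∀ n, u n ≤ 1) {a : ℝ} (h : limsup u atTop < a) :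
    ∀ᶠ n in atTop, u n < a :=
  eventually_lt_of_limsup_lt h (isBoundedUnder_of ⟨1, h1⟩ : IsBoundedUnder (· ≤ ·) atTop u)

section
variable {α : Type*} (P : Dist α)

theorem pr_eq (A : Set α) : P.pr A = ∑' x, A.indicator P.p x := tsum_subtype A P.p

theorem summ (A : Set α) : Summable (A.indicator P.p) := P.hasSum.summable.indicator A

theorem ind_nonneg (A : Set α) (x : α) : 0 ≤ A.indicator P.p x :=
  Set.indicator_nonneg (fun x _ => P.nonneg x) x

theorem pr_nonneg (A : Set α) : 0 ≤ P.pr A := by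
  rw [pr_eq]; exact tsum_nonneg (ind_nonneg P A)

theorem pr_mono {A B : Set α} (h : ∀ x, 0 < P.p x → x ∈ A → x ∈ B) : P.pr A ≤ P.pr B := by
  rw [pr_eq, pr_eq]
  refine (summ P A).tsum_le_tsum (fun x => ?_) (summ P B)
  by_cases hA : x ∈ A
  · rcases (P.nonneg x).eq_or_lt with h0 | h0
    · rw [Set.indicator_of_mem hA, ← h0]; exact ind_nonneg P B x
    · rw [Set.indicator_of_mem hA, Set.indicator_of_mem (h x h0 hA)]
  · rw [Set.indicator_of_notMem hA]; exact ind_nonneg P B x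

theorem pr_univ : P.pr Set.univ = 1 := by
  rw [pr_eq]; simp [P.hasSum.tsum_eq]

theorem pr_le_one (A : Set α) : P.pr A ≤ 1 := by
  rw [← pr_univ P]; exact pr_mono P fun x _ _ => trivial

theorem pr_union {A B : Set α} (h : Disjoint A B) : P.pr (A ∪ B) = P.pr A + P.pr B := by
  rw [pr_eq, pr_eq, pr_eq, ← (summ P A).tsum_add (summ P B), Set.indicator_union_of_disjoint h]

theorem pr_compl (A : Set α) : P.pr Aᶜ = 1 - P.pr A := by
  have := pr_union P (disjoint_compl_right (a := A))
  rw [Set.union_compl_self, pr_univ] at this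
  linarith

theorem p_le_pr {A : Set α} {x : α} (h : x ∈ A) : P.p x ≤ P.pr A := by
  rw [pr_eq, ← Set.indicator_of_mem h P.p]
  exact (summ P A).le_tsum x fun y _ => ind_nonneg P A y

theorem pr_finset (F : Finset α) : P.pr (F : Set α) = ∑ x ∈ F, P.p x := by
  unfold Dist.pr
  exact Finset.tsum_subtype F P.p

theorem greedy (δ η : ℝ) (hδ : 0 ≤ δ) (hη : 0 < η) (F : Finset α) :
    (∀ x ∈ F, P.p x ≤ η) → ∃ F' ⊆ F, ∑ x ∈ F', P.p x ≤ δ ∧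
      min (∑ x ∈ F, P.p x) δ - η ≤ ∑ x ∈ F', P.p x := by
  classical
  induction F using Finset.induction_on with
  | empty => intro _; exact ⟨∅, le_rfl, by simpa using hδ, by simp [hδ, hη.le]⟩
  | insert a F ha ih =>
    intro h
    obtain ⟨F', hF, h1, h2⟩ := ih fun x hx => h x (Finset.mem_insert_of_mem hx)
    have haF : a ∉ F' := fun h => ha (hF h)
    have hpa := h a (Finset.mem_insert_self _ _)
    have hp0 := P.nonneg a
    by_cases hc : P.p a + ∑ x ∈ F', P.p x ≤ δ
    · refine ⟨insert a F', Finset.insert_subset_insert _ hF, ?_, ?_⟩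
      · rwa [Finset.sum_insert haF]
      · rw [Finset.sum_insert haF, Finset.sum_insert ha]
        rcases le_total (∑ x ∈ F, P.p x) δ with h3 | h3
        · rw [min_eq_left h3] at h2
          have := min_le_left (P.p a + ∑ x ∈ F, P.p x) δ
          linarith
        · rw [min_eq_right h3] at h2
          have := min_le_right (P.p a + ∑ x ∈ F, P.p x) δ
          linarith
    · refine ⟨F', hF.trans (Finset.subset_insert _ _), h1, ?_⟩
      have := min_le_right (∑ x ∈ insert a F, P.p x) δ
      linarith

theorem select (B : Set α) (δ η : ℝ) (hδ : 0 ≤ δ) (hη : 0 < η) (hB : ∀ x ∈ B, P.p x ≤ η) :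
    ∃ B' ⊆ B, P.pr B' ≤ δ ∧ min (P.pr B) δ - 2 * η ≤ P.pr B' := by
  classical
  have hs : Summable fun x : B => P.p x.1 := P.hasSum.summable.subtype B
  obtain ⟨s, hs'⟩ := (hs.hasSum.eventually (lt_mem_nhds
    (show P.pr B - η < ∑' x : B, P.p x.1 by unfold Dist.pr; linarith))).exists
  set F : Finset α := s.map (Function.Embedding.subtype _) with hF
  have hFs : ∑ x ∈ F, P.p x = ∑ x ∈ s, P.p x.1 := by simp [hF]
  have hFB : ∀ x ∈ F, x ∈ B := by
    intro x hx
    simp only [hF, Finset.mem_map, Function.Embedding.subtype_apply] at hx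
    obtain ⟨y, _, rfl⟩ := hx
    exact y.2
  obtain ⟨F', h1, h2, h3⟩ := greedy P δ η hδ hη F fun x hx => hB x (hFB x hx)
  refine ⟨F', fun x hx => hFB x (h1 hx), ?_, ?_⟩
  · rwa [pr_finset]
  · rw [pr_finset]
    refine le_trans ?_ h3
    rw [hFs]
    have : min (P.pr B) δ - η ≤ min (∑ x ∈ s, P.p x.1) δ := by
      apply le_min
      · have := min_le_left (P.pr B) δ
        linarith
      · have := min_le_right (P.pr B) δ
        linarith
    linarith

end

/-- G_{ε,δ}(R|X) = H̄_{ε+δ}(R|X). -/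
theorem statement12 {𝒳 : Type*} [Countable 𝒳] (K : ℕ) (hK : 2 ≤ K) (X : Source 𝒳)
    (R ε δ : ℝ) (hR : 0 ≤ R)
    (hε0 : 0 ≤ ε) (hε1 : ε < 1) (hδ0 : 0 ≤ δ) (hδ1 : δ < 1) (hεδ : ε + δ < 1) :
    Gsecond K X ε δ R = Hbar2 K X (ε + δ) R := by
  have hK1 : (1 : ℝ) < K := by exact_mod_cast hK
  have sqT : Tendsto (fun n : ℕ => Real.sqrt (n : ℝ)) atTop atTop :=
    Real.tendsto_sqrt_atTop.comp tendsto_natCast_atTop_atTop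
  have hsInf0 : ∀ (L ν : ℝ) (n : ℕ), 0 ≤ sInf ((fun A : Set (Fin n → 𝒳) =>
        (X n).pr (A ∩ {x | -Real.logb (K : ℝ) ((X n).p x / (X n).pr A) / (n : ℝ)
          ≥ R + L / Real.sqrt (n : ℝ)})) ''
      {A | (X n).pr A ≥ 1 - ε - ν}) := by
    intro L ν n
    apply Real.sInf_nonneg
    rintro _ ⟨A, _, rfl⟩
    exact pr_nonneg _ _
  have hbdd : ∀ (L ν : ℝ) (n : ℕ), BddBelow ((fun A : Set (Fin n → 𝒳) =>
        (X n).pr (A ∩ {x | -Real.logb (K : ℝ) ((X n).p x / (X n).pr A) / (n : ℝ)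
          ≥ R + L / Real.sqrt (n : ℝ)})) ''
      {A | (X n).pr A ≥ 1 - ε - ν}) := by
    intro L ν n
    refine ⟨0, ?_⟩
    rintro _ ⟨A, _, rfl⟩
    exact pr_nonneg _ _
  have hsInf1 : ∀ (L ν : ℝ) (n : ℕ), 0 < ν → sInf ((fun A : Set (Fin n → 𝒳) =>
        (X n).pr (A ∩ {x | -Real.logb (K : ℝ) ((X n).p x / (X n).pr A) / (n : ℝ)
          ≥ R + L / Real.sqrt (n : ℝ)})) ''
      {A | (X n).pr A ≥ 1 - ε - ν}) ≤ 1 := by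
    intro L ν n hν
    refine (csInf_le (hbdd L ν n) ⟨Set.univ, ?_, rfl⟩).trans (pr_le_one _ _)
    simp only [Set.mem_ofPred_eq, pr_univ]
    linarith
  apply sInf_eq_aux
  · intro L hL L' hLL'
    simp only [Set.mem_ofPred_eq] at hL ⊢
    refine le_of_forall_pos_le_add fun γ hγ => ?_
    obtain ⟨ν, hν, hνγ, hν1⟩ : ∃ ν > 0, 2 * ν ≤ γ ∧ ν < 1 - ε := by
      refine ⟨min (γ / 2) ((1 - ε) / 2), lt_min (by linarith) (by linarith), ?_, ?_⟩
      · have := min_le_left (γ / 2) ((1 - ε) / 2)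
        linarith
      · have := min_le_right (γ / 2) ((1 - ε) / 2)
        linarith
    have hg : _ ≤ δ := le_trans (le_csSup ?_ (Set.mem_image_of_mem _ (Set.mem_Ioi.2 hν))) hL
    swap
    · refine ⟨1, ?_⟩
      rintro _ ⟨ν', hν', rfl⟩
      exact ls_le (hsInf0 L ν') (Eventually.of_forall fun n => hsInf1 L ν' n hν')
    have hev := ls_lt (fun n => hsInf1 L ν n hν) (lt_of_le_of_lt hg (by linarith : δ < δ + ν))
    apply ls_le (fun n => pr_nonneg _ _)
    filter_upwards [hev, sqT.eventually_ge_atTop (-Real.logb K (1 - ε - ν) / (L' - L)),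
      eventually_gt_atTop 0] with n h1 h2 hn
    obtain ⟨_, ⟨A, hA, rfl⟩, h3⟩ := exists_lt_of_csInf_lt
      ⟨_, Set.mem_image_of_mem _ (show Set.univ ∈ {A | (X n).pr A ≥ 1 - ε - ν} by
        simp only [Set.mem_ofPred_eq, pr_univ]; linarith)⟩ h1
    simp only [Set.mem_ofPred_eq] at hA
    have hn' : (0 : ℝ) < n := by exact_mod_cast hn
    have hsq := Real.sqrt_pos.2 hn'
    have hApos : 0 < (X n).pr A := by linarith
    have hlog : Real.logb K (1 - ε - ν) ≤ Real.logb K ((X n).pr A) :=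
      Real.logb_le_logb_of_le hK1 (by linarith) hA
    rw [div_le_iff₀ (by linarith)] at h2
    refine (pr_mono (X n) (B := Aᶜ ∪ (A ∩ {x | -Real.logb (K : ℝ) ((X n).p x / (X n).pr A) / (n : ℝ)
          ≥ R + L / Real.sqrt (n : ℝ)})) ?_).trans ?_
    · intro x hx hxL
      by_cases hxA : x ∈ A
      · refine Or.inr ⟨hxA, ?_⟩
        simp only [Set.mem_ofPred_eq, gt_iff_lt, ge_iff_le] at hxL ⊢
        rw [one_div, Real.logb_inv] at hxL
        rw [Real.logb_div hx.ne' hApos.ne']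
        have e1 : L' / √n = L / √n + (√n * (L' - L)) / n := by
          field_simp
          rw [Real.sq_sqrt hn'.le]; ring
        have e2 : 0 ≤ (√n * (L' - L) + Real.logb K ((X n).pr A)) / n :=
          div_nonneg (by linarith) hn'.le
        have e3 : -(Real.logb K ((X n).p x) - Real.logb K ((X n).pr A)) / (n : ℝ)
          = -Real.logb K ((X n).p x) / n + (√n * (L' - L) + Real.logb K ((X n).pr A)) / n
            - (√n * (L' - L)) / n := by ring
        rw [e3]
        linarith
      · exact Or.inl hxA
    · rw [pr_union, pr_compl]
      · linarith
      · exact Set.disjoint_left.2 fun x h h' => h h'.1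
  · intro L hL L' hLL'
    simp only [Set.mem_ofPred_eq] at hL ⊢
    obtain ⟨M, hLM, hML⟩ := exists_between hLL'
    obtain ⟨c, hc, hcM⟩ : ∃ c > 0, ∀ᶠ n : ℕ in atTop, c ≤ √(n : ℝ) * R + M := by
      rcases hR.eq_or_lt with h0 | h0
      · subst h0
        refine ⟨M, ?_, by simp⟩
        by_contra hM
        push Not at hM
        have hev := ls_lt (fun n => pr_le_one _ _) (lt_of_le_of_lt hL hεδ)
        obtain ⟨n, h1, hn⟩ := (hev.and (eventually_gt_atTop 0)).exists
        have hn' : (0 : ℝ) < n := by exact_mod_cast hn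
        refine absurd h1 (not_lt.2 ?_)
        refine (pr_univ (X n)).symm.le.trans (pr_mono _ fun x hx _ => ?_)
        simp only [Set.mem_ofPred_eq, gt_iff_lt, zero_add]
        refine lt_of_lt_of_le (div_neg_of_neg_of_pos (by linarith) (Real.sqrt_pos.2 hn')) ?_
        refine div_nonneg (Real.logb_nonneg hK1 ?_) hn'.le
        rw [le_div_iff₀ hx, one_mul]
        exact (p_le_pr _ (Set.mem_univ x)).trans (pr_le_one _ _)
      · refine ⟨1, one_pos, ?_⟩
        filter_upwards [sqT.eventually_ge_atTop ((1 - M) / R)] with n hn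
        rw [div_le_iff₀ h0] at hn
        linarith
    refine csSup_le ((Set.nonempty_Ioi).image _) ?_
    rintro _ ⟨ν, hν, rfl⟩
    rw [Set.mem_Ioi] at hν
    apply ls_le (hsInf0 L' ν)
    have hev := ls_lt (fun n => pr_le_one _ _)
      (lt_of_le_of_lt hL (by linarith : ε + δ < ε + δ + ν / 2))
    filter_upwards [hev, hcM, sqT.eventually_ge_atTop (-Real.logb K (ν / 4) / c),
      eventually_gt_atTop 0] with n h1 h2 h3 hn
    have hn' : (0 : ℝ) < n := by exact_mod_cast hn
    have hsq := Real.sqrt_pos.2 hn'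
    set B : Set (Fin n → 𝒳) := {x | 0 < (X n).p x ∧
      Real.logb (K : ℝ) (1 / (X n).p x) / (n : ℝ) > R + M / Real.sqrt (n : ℝ)} with hBdef
    have hBpr : (X n).pr B < ε + δ + ν / 2 := by
      refine lt_of_le_of_lt (pr_mono _ fun x _ hx => ?_) h1
      refine lt_trans ?_ hx.2
      gcongr
    have hBη : ∀ x ∈ B, (X n).p x ≤ ν / 4 := by
      rintro x ⟨hx, hx'⟩
      rw [← Real.logb_le_logb hK1 hx (by linarith)]
      rw [one_div, Real.logb_inv, gt_iff_lt, lt_div_iff₀ hn'] at hx'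
      rw [div_le_iff₀ hc] at h3
      have e : (R + M / √n) * n = √n * (√n * R + M) := by
        nth_rewrite 2 [← Real.sq_sqrt hn'.le]
        field_simp
      have := mul_le_mul_of_nonneg_left h2 hsq.le
      rw [e] at hx'
      linarith
    obtain ⟨B', hB'B, hB'δ, hB'⟩ := select (X n) B δ (ν / 4) hδ0 (by linarith) hBη
    have hdis : Disjoint Bᶜ B' := Set.disjoint_left.2 fun x h h' => h (hB'B h')
    refine (csInf_le (hbdd L' ν n) ⟨Bᶜ ∪ B', ?_, rfl⟩).trans ?_
    · simp only [Set.mem_ofPred_eq]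
      rw [pr_union _ hdis, pr_compl]
      rcases min_choice ((X n).pr B) δ with h | h <;> rw [h] at hB' <;> linarith
    · refine (pr_mono _ fun x hx hxA => ?_).trans hB'δ
      obtain ⟨hxA, hx2⟩ := hxA
      have hq := lt_of_lt_of_le hx (p_le_pr (X n) hxA)
      rcases hxA with h | h
      · exfalso
        refine h ⟨hx, ?_⟩
        simp only [Set.mem_ofPred_eq, ge_iff_le] at hx2
        rw [Real.logb_div hx.ne' hq.ne'] at hx2
        rw [one_div, Real.logb_inv]
        have hl : Real.logb K ((X n).pr (Bᶜ ∪ B')) ≤ 0 :=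
          Real.logb_nonpos hK1 hq.le (pr_le_one _ _)
        have e1 : R + M / √n < R + L' / √n := by gcongr
        refine lt_of_lt_of_le e1 (hx2.trans ?_)
        gcongr
        linarith
      · exact h
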